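/- arXiv:2601.08730 — 3 statements merged into one kernel-verified Lean document; each statement's English description precedes it below -/
import Mathlib

section
/- Let T > 0 and let π = (π_N) be a sequence of partitions of [0,T] with mesh tending to 0. Let V¹ and V² be finite-dimensional real inner product spaces, and for α ∈ {1,2} let X^α : [0,T] → V^α be a continuous path with vanishing p_α-th variation along π, where 1 ≤ p₁ ≤ 2, 1 ≤ p₂ ≤ 3 and 1/p₁ + 1/p₂ ≥ 1. For i = 0,…,n let F^i : V¹ × V² → ℝ be three times continuously differentiable on a neighbourhood of the set {(X¹_t, X²_t) : t ∈ [0,T]}, and let q^i : [0,T] → ℝ be bounded functions. Suppose that for all t ∈ [0,T): (1) Σ_{i=0}^n q^i_t · D_V F^i(X¹_t, X²_t) = 0 for every first-order directional derivative in any direction V belonging to V¹ or to V², and (2) Σ_{i=0}^n q^i_t · D_{V₁}D_{V₂} F^i(X¹_t, X²_t) = 0 for all second-order directional derivatives in directions V₁, V₂ ∈ V². Then lim_{N→∞} Σ_{[u,v]∈π_N} Σ_{i=0}^n q^i_u ( F^i(X¹_v, X²_v) − F^i(X¹_u, X²_u) ) = 0. -/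
open Filter Topology

/-- A sequence of partitions of `[0, T]` with mesh tending to zero.
For each `N`, the partition `π_N` has points `t N 0 = 0 < t N 1 < ⋯ < t N (c N) = T`. -/
structure PartitionSeq (T : ℝ) : Type where
  c : ℕ → ℕ
  t : ℕ → ℕ → ℝ
  c_pos : ∀ N, 0 < c N
  first : ∀ N, t N 0 = 0
  last : ∀ N, t N (c N) = T
  mono : ∀ N, ∀ i < c N, t N i < t N (i + 1)
  mesh_to_zero : ∀ ε > 0, ∃ M : ℕ, ∀ N ≥ M, ∀ i < c N, t N (i + 1) - t N i < ε

/-- A path `X` has vanishing `p`-th variation along the partition sequence `π` if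
`Σ_{[u,v] ∈ π_N} ‖X_v - X_u‖^p → 0` as `N → ∞`. -/
def VanishingVariation {V : Type*} [NormedAddCommGroup V] {T : ℝ}
    (π : PartitionSeq T) (p : ℝ) (X : ℝ → V) : Prop :=
  Tendsto (fun N => ∑ i ∈ Finset.range (π.c N),
    ‖X (π.t N (i + 1)) - X (π.t N i)‖ ^ p) atTop (nhds 0)

section Taylor

variable {E G : Type*} [NormedAddCommGroup E] [NormedSpace ℝ E]
  [NormedAddCommGroup G] [NormedSpace ℝ G]

/-- Second-order Taylor estimate on a convex set, when the second derivative varies at most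
linearly around the base point. -/
theorem Convex.norm_taylor_two_le {f : E → G} {f' : E → E →L[ℝ] G} {f'' : E → E →L[ℝ] E →L[ℝ] G}
    {s : Set E} (hs : Convex ℝ s) {C : ℝ} (hC : 0 ≤ C) {x y : E} (hx : x ∈ s) (hy : y ∈ s)
    (hf : ∀ z ∈ s, HasFDerivAt f (f' z) z) (hf' : ∀ z ∈ s, HasFDerivAt f' (f'' z) z)
    (hlip : ∀ z ∈ s, ‖f'' z - f'' x‖ ≤ C * ‖z - x‖) (hsymm : ∀ v w, f'' x v w = f'' x w v) :
    ‖f y - f x - f' x (y - x) - (1 / 2 : ℝ) • f'' x (y - x) (y - x)‖ ≤ C * ‖y - x‖ ^ 3 := by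
  have hconv (ρ : ℝ) : Convex ℝ (s ∩ Metric.closedBall x ρ) := hs.inter (convex_closedBall x ρ)
  have hmem {z : E} (hz : z ∈ s) : z ∈ s ∩ Metric.closedBall x ‖z - x‖ :=
    ⟨hz, by simp [dist_eq_norm]⟩
  have hbase (ρ : ℝ) (hρ : 0 ≤ ρ) : x ∈ s ∩ Metric.closedBall x ρ :=
    ⟨hx, by simpa using hρ⟩
  have hfirst (z : E) (hz : z ∈ s) : ‖f' z - f' x - f'' x (z - x)‖ ≤ C * ‖z - x‖ ^ 2 := by
    have := (hconv ‖z - x‖).norm_image_sub_le_of_norm_hasFDerivWithin_le' (f := f') (f' := f'')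
      (φ := f'' x) (C := C * ‖z - x‖) (fun w hw => (hf' w hw.1).hasFDerivWithinAt)
      (fun w hw => (hlip w hw.1).trans
        (mul_le_mul_of_nonneg_left (by simpa [dist_eq_norm] using hw.2) hC))
      (hbase _ (norm_nonneg _)) (hmem hz)
    linarith
  let g : E → G := fun z => f z - f' x (z - x) - (1 / 2 : ℝ) • f'' x (z - x) (z - x)
  have hg (z : E) (hz : z ∈ s) : HasFDerivAt g (f' z - f' x - f'' x (z - x)) z := by
    have hid : HasFDerivAt (fun w : E => w - x) (ContinuousLinearMap.id ℝ E) z :=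
      (hasFDerivAt_id z).sub_const x
    have hlin := (f' x).hasFDerivAt.comp z hid
    have hquad := ((((f'' x).hasFDerivAt.comp z hid).clm_apply hid).const_smul (1 / 2 : ℝ))
    refine (((hf z hz).sub hlin).sub hquad).congr_fderiv ?_
    ext v
    simp [hsymm v]
    module
  have := (hconv ‖y - x‖).norm_image_sub_le_of_norm_hasFDerivWithin_le (f := g)
    (C := C * ‖y - x‖ ^ 2) (fun w hw => (hg w hw.1).hasFDerivWithinAt)
    (fun w hw => (hfirst w hw.1).trans (by
      have : ‖w - x‖ ≤ ‖y - x‖ := by simpa [dist_eq_norm] using hw.2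
      gcongr))
    (hbase _ (norm_nonneg _)) (hmem hy)
  have heq : g y - g x =
      f y - f x - f' x (y - x) - (1 / 2 : ℝ) • f'' x (y - x) (y - x) := by
    simp only [g, sub_self, map_zero, smul_zero, sub_zero]
    abel
  rw [heq] at this
  linarith

/-- Near each point of smoothness, the second-order Taylor remainder is cubic, uniformly in the
base point. -/
theorem ContDiffAt.exists_ball_norm_taylor_two_le {f : E → G} {x₀ : E}
    (hf : ContDiffAt ℝ 3 f x₀) :
    ∃ C : ℝ, ∃ r > 0, ∀ x ∈ Metric.ball x₀ r, ∀ y ∈ Metric.ball x₀ r,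
      ‖f y - f x - fderiv ℝ f x (y - x) - (1 / 2 : ℝ) • fderiv ℝ (fderiv ℝ f) x (y - x) (y - x)‖
        ≤ C * ‖y - x‖ ^ 3 := by
  have hf2 : ContDiffAt ℝ 1 (fderiv ℝ (fderiv ℝ f)) x₀ :=
    (hf.fderiv_right (m := 2) (by norm_num)).fderiv_right (by norm_num)
  obtain ⟨K, t, ht, hK⟩ := hf2.exists_lipschitzOnWith
  obtain ⟨r, hr, hball⟩ := Metric.mem_nhds_iff.mp (inter_mem ht (hf.eventually (by simp)))
  refine ⟨K, r, hr, fun x hx y hy => ?_⟩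
  have hd (z : E) (hz : z ∈ Metric.ball x₀ r) : ContDiffAt ℝ 3 f z := (hball hz).2
  refine (convex_ball x₀ r).norm_taylor_two_le K.2 hx hy
    (fun z hz => ((hd z hz).differentiableAt (by simp)).hasFDerivAt)
    (fun z hz => (((hd z hz).fderiv_right (m := 2) (by norm_num)).differentiableAt
      (by simp)).hasFDerivAt) (fun z hz => ?_) (fun v w => ?_)
  · simpa [dist_eq_norm] using hK.dist_le_mul z (hball hz).1 x (hball hx).1
  · exact ((hd x hx).isSymmSndFDerivAt (by simp; norm_cast)) v w

/-- The second-order Taylor remainder is cubic, uniformly over base points in a compact set. -/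
theorem IsCompact.exists_norm_taylor_two_le {f : E → G} {K : Set E} (hK : IsCompact K)
    (hf : ∀ x ∈ K, ContDiffAt ℝ 3 f x) :
    ∃ C : ℝ, ∃ δ > 0, ∀ x ∈ K, ∀ y, ‖y - x‖ < δ →
      ‖f y - f x - fderiv ℝ f x (y - x) - (1 / 2 : ℝ) • fderiv ℝ (fderiv ℝ f) x (y - x) (y - x)‖
        ≤ C * ‖y - x‖ ^ 3 := by
  refine hK.induction_on (p := fun s => ∃ C : ℝ, ∃ δ > 0, ∀ x ∈ s, ∀ y, ‖y - x‖ < δ →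
      ‖f y - f x - fderiv ℝ f x (y - x) - (1 / 2 : ℝ) • fderiv ℝ (fderiv ℝ f) x (y - x) (y - x)‖
        ≤ C * ‖y - x‖ ^ 3) ⟨0, 1, one_pos, by simp⟩ ?_ ?_ ?_
  · rintro s t hst ⟨C, δ, hδ, h⟩
    exact ⟨C, δ, hδ, fun x hx => h x (hst hx)⟩
  · rintro s t ⟨C₁, δ₁, hδ₁, h₁⟩ ⟨C₂, δ₂, hδ₂, h₂⟩
    refine ⟨max C₁ C₂, min δ₁ δ₂, lt_min hδ₁ hδ₂, ?_⟩
    rintro x (hx | hx) y hy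
    · exact (h₁ x hx y (hy.trans_le (min_le_left _ _))).trans
        (by gcongr; exact le_max_left _ _)
    · exact (h₂ x hx y (hy.trans_le (min_le_right _ _))).trans
        (by gcongr; exact le_max_right _ _)
  · intro x₀ hx₀
    obtain ⟨C, r, hr, h⟩ := (hf x₀ hx₀).exists_ball_norm_taylor_two_le
    refine ⟨Metric.ball x₀ (r / 2), mem_nhdsWithin_of_mem_nhds (Metric.ball_mem_nhds _ (by simpa)),
      C, r / 2, half_pos hr, fun x hx y hy => ?_⟩
    refine h x (Metric.ball_subset_ball (by linarith) hx) y ?_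
    rw [Metric.mem_ball] at hx ⊢
    rw [← dist_eq_norm] at hy
    linarith [dist_triangle y x x₀]

end Taylor

theorem Real.pow_le_rpow_of_le_one {a p : ℝ} {m : ℕ} (ha : 0 ≤ a) (ha1 : a ≤ 1) (hp : 0 ≤ p)
    (hpm : p ≤ m) : a ^ m ≤ a ^ p := by
  rw [← Real.rpow_natCast]
  exact Real.rpow_le_rpow_of_exponent_ge' ha ha1 hp hpm

/-- A form of Young's inequality with exponents that need not be conjugate, when the second
number is at most one. -/
theorem Real.mul_le_rpow_add_rpow_of_le_one {a b p₁ p₂ : ℝ} (ha : 0 ≤ a)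
    (hb : 0 ≤ b) (hb1 : b ≤ 1) (hp₁ : 1 ≤ p₁) (hp₂ : 1 ≤ p₂) (hp : 1 ≤ 1 / p₁ + 1 / p₂) :
    a * b ≤ a ^ p₁ + b ^ p₂ := by
  have hap := Real.rpow_nonneg ha p₁
  have hbp := Real.rpow_nonneg hb p₂
  rcases hp₁.eq_or_lt with rfl | hlt
  · rw [Real.rpow_one]
    nlinarith
  · have hconj := Real.HolderConjugate.conjExponent hlt
    have hq : p₂ ≤ p₁.conjExponent := by
      have := hconj.inv_add_inv_eq_one
      simp only [one_div] at hp
      exact (inv_le_inv₀ hconj.symm.pos (by linarith)).mp (by linarith)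
    have hbq := Real.rpow_le_rpow_of_exponent_ge' hb hb1 (by linarith) hq
    have hbq0 := Real.rpow_nonneg hb p₁.conjExponent
    calc a * b ≤ a ^ p₁ / p₁ + b ^ p₁.conjExponent / p₁.conjExponent :=
          Real.young_inequality_of_nonneg ha hb hconj
      _ ≤ a ^ p₁ + b ^ p₁.conjExponent :=
          add_le_add (div_le_self hap hp₁) (div_le_self hbq0 hconj.symm.lt.le)
      _ ≤ a ^ p₁ + b ^ p₂ := by gcongr

/-- A bilinear form on a product, up to its restriction to the second factor. -/
theorem ContinuousLinearMap.abs_apply_sub_apply_snd_le {V1 V2 : Type*}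
    [NormedAddCommGroup V1] [NormedSpace ℝ V1] [NormedAddCommGroup V2] [NormedSpace ℝ V2]
    (B : V1 × V2 →L[ℝ] V1 × V2 →L[ℝ] ℝ) (h : V1 × V2) :
    |B h h - B (0, h.2) (0, h.2)| ≤ ‖B‖ * (‖h.1‖ ^ 2 + 2 * (‖h.1‖ * ‖h.2‖)) := by
  have hdecomp : h = (h.1, 0) + (0, h.2) := by simp
  have heq : B h h - B (0, h.2) (0, h.2) =
      B (h.1, 0) (h.1, 0) + B (h.1, 0) (0, h.2) + B (0, h.2) (h.1, 0) := by
    conv_lhs => enter [1]; rw [hdecomp]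
    simp only [map_add, add_apply]
    ring
  have h11 := B.le_opNorm₂ (h.1, 0) (h.1, 0)
  have h12 := B.le_opNorm₂ (h.1, 0) (0, h.2)
  have h21 := B.le_opNorm₂ (0, h.2) (h.1, 0)
  simp only [Prod.norm_mk, norm_zero, norm_nonneg, sup_of_le_left, sup_of_le_right] at h11 h12 h21
  rw [heq]
  refine (abs_add_three _ _ _).trans ?_
  simp only [← Real.norm_eq_abs]
  linarith

/-- Taylor estimate with the first-order term and the second-order term in the directions of the
second factor kept exact, and the remainder measured by powers of the increments. -/
theorem IsCompact.exists_abs_taylor_snd_le {V1 V2 : Type*}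
    [NormedAddCommGroup V1] [NormedSpace ℝ V1] [NormedAddCommGroup V2] [NormedSpace ℝ V2]
    {p₁ p₂ : ℝ} (hp₁ : 1 ≤ p₁) (hp₁' : p₁ ≤ 2) (hp₂ : 1 ≤ p₂) (hp₂' : p₂ ≤ 3)
    (hp : 1 ≤ 1 / p₁ + 1 / p₂) {f : V1 × V2 → ℝ} {K : Set (V1 × V2)} (hK : IsCompact K)
    (hf : ∀ x ∈ K, ContDiffAt ℝ 3 f x) :
    ∃ C ≥ 0, ∃ δ > 0, ∀ x ∈ K, ∀ y, ‖y - x‖ < δ →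
      |f y - f x - (fderiv ℝ f x (y - x) +
          1 / 2 * fderiv ℝ (fderiv ℝ f) x (0, (y - x).2) (0, (y - x).2))|
        ≤ C * (‖(y - x).1‖ ^ p₁ + ‖(y - x).2‖ ^ p₂) := by
  obtain ⟨C, δ, hδ, hC⟩ := hK.exists_norm_taylor_two_le hf
  have hcont : ContinuousOn (fderiv ℝ (fderiv ℝ f)) K := fun x hx =>
    (((hf x hx).fderiv_right (m := 2) (by norm_num)).fderiv_right (m := 1)
      (by norm_num)).continuousAt.continuousWithinAt
  obtain ⟨M, hM⟩ := hK.exists_bound_of_continuousOn (f := fderiv ℝ (fderiv ℝ f)) hcont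
  refine ⟨|C| + 2 * |M|, by positivity, min δ 1, lt_min hδ one_pos, fun x hx y hxy => ?_⟩
  have htaylor := hC x hx y (hxy.trans_le (min_le_left _ _))
  have hone : ‖y - x‖ ≤ 1 := hxy.le.trans (min_le_right _ _)
  have hbil := (fderiv ℝ (fderiv ℝ f) x).abs_apply_sub_apply_snd_le (y - x)
  have hMx : ‖fderiv ℝ (fderiv ℝ f) x‖ ≤ |M| := (hM x hx).trans (le_abs_self M)
  generalize fderiv ℝ (fderiv ℝ f) x = B at *
  generalize y - x = h at *
  have hh1 : ‖h.1‖ ≤ 1 := (norm_fst_le h).trans hone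
  have hh2 : ‖h.2‖ ≤ 1 := (norm_snd_le h).trans hone
  set a := ‖h.1‖
  set b := ‖h.2‖
  have ha0 : 0 ≤ a := norm_nonneg _
  have hb0 : 0 ≤ b := norm_nonneg _
  have hab := Real.mul_le_rpow_add_rpow_of_le_one ha0 hb0 hh2 hp₁ hp₂ hp
  have hbp0 := Real.rpow_nonneg hb0 p₂
  have hap0 := Real.rpow_nonneg ha0 p₁
  have ha2 : a ^ 2 ≤ a ^ p₁ :=
    Real.pow_le_rpow_of_le_one ha0 hh1 (by linarith) (by exact_mod_cast hp₁')
  have ha3 : a ^ 3 ≤ a ^ p₁ :=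
    Real.pow_le_rpow_of_le_one ha0 hh1 (by linarith) (by norm_num; linarith)
  have hb3 : b ^ 3 ≤ b ^ p₂ :=
    Real.pow_le_rpow_of_le_one hb0 hh2 (by linarith) (by exact_mod_cast hp₂')
  have hcube : ‖h‖ ^ 3 ≤ a ^ p₁ + b ^ p₂ := by
    rcases max_choice a b with hm | hm <;> rw [Prod.norm_def, hm] <;> linarith
  rw [Real.norm_eq_abs, smul_eq_mul] at htaylor
  have hquad : ‖B‖ * (a ^ 2 + 2 * (a * b)) ≤ |M| * (4 * (a ^ p₁ + b ^ p₂)) := by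
    have hsum : a ^ 2 + 2 * (a * b) ≤ 4 * (a ^ p₁ + b ^ p₂) := by linarith
    exact mul_le_mul hMx hsum (by positivity) (abs_nonneg M)
  have hrem : C * ‖h‖ ^ 3 ≤ |C| * (a ^ p₁ + b ^ p₂) :=
    mul_le_mul (le_abs_self C) hcube (by positivity) (abs_nonneg C)
  rw [abs_le] at *
  constructor <;> linarith [htaylor.1, htaylor.2, hbil.1, hbil.2]

namespace PartitionSeq

variable {T : ℝ} (π : PartitionSeq T)

theorem t_strictMonoOn (N : ℕ) : StrictMonoOn (π.t N) (Set.Iic (π.c N)) :=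
  strictMonoOn_Iic_of_lt_succ fun i hi => π.mono N i hi

theorem t_mem_Icc {N i : ℕ} (hi : i ≤ π.c N) : π.t N i ∈ Set.Icc 0 T := by
  have hmono := (π.t_strictMonoOn N).monotoneOn
  constructor
  · simpa [π.first N] using hmono (Set.mem_Iic.2 (Nat.zero_le _)) hi (Nat.zero_le i)
  · simpa [π.last N] using hmono hi (Set.mem_Iic.2 le_rfl) hi

theorem t_mem_Ico {N i : ℕ} (hi : i < π.c N) : π.t N i ∈ Set.Ico 0 T :=
  ⟨(π.t_mem_Icc hi.le).1, (π.mono N i hi).trans_le (π.t_mem_Icc hi).2⟩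

/-- The increments of a continuous path along the partitions tend to zero uniformly. -/
theorem eventually_norm_sub_lt {V : Type*} [NormedAddCommGroup V] {X : ℝ → V}
    (hX : ContinuousOn X (Set.Icc 0 T)) {δ : ℝ} (hδ : 0 < δ) :
    ∀ᶠ N in atTop, ∀ k < π.c N, ‖X (π.t N (k + 1)) - X (π.t N k)‖ < δ := by
  obtain ⟨ε, hε, h⟩ := Metric.uniformContinuousOn_iff.mp
    (isCompact_Icc.uniformContinuousOn_of_continuous hX) δ hδ
  obtain ⟨M, hM⟩ := π.mesh_to_zero ε hε
  filter_upwards [eventually_ge_atTop M] with N hN k hk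
  rw [← dist_eq_norm]
  refine h _ (π.t_mem_Icc hk) _ (π.t_mem_Icc hk.le) ?_
  rw [Real.dist_eq, abs_of_pos (sub_pos.2 (π.mono N k hk))]
  exact hM N hN k hk

end PartitionSeq

/-- Theorem 1 (main theorem): vanishing profit-and-loss of a discretely rebalanced
first- and second-order neutral portfolio, via Taylor's theorem. -/
theorem vanishing_pnl
    {V1 V2 : Type*}
    [NormedAddCommGroup V1] [InnerProductSpace ℝ V1] [FiniteDimensional ℝ V1]
    [NormedAddCommGroup V2] [InnerProductSpace ℝ V2] [FiniteDimensional ℝ V2]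
    (T : ℝ) (hT : 0 < T) (π : PartitionSeq T)
    (p1 p2 : ℝ) (hp1 : 1 ≤ p1) (hp1' : p1 ≤ 2) (hp2 : 1 ≤ p2) (hp2' : p2 ≤ 3)
    (hp : 1 ≤ 1 / p1 + 1 / p2)
    (X1 : ℝ → V1) (X2 : ℝ → V2)
    (hX1c : ContinuousOn X1 (Set.Icc 0 T)) (hX2c : ContinuousOn X2 (Set.Icc 0 T))
    (hX1 : VanishingVariation π p1 X1) (hX2 : VanishingVariation π p2 X2)
    (n : ℕ) (F : ℕ → V1 × V2 → ℝ) (q : ℕ → ℝ → ℝ)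
    -- each `F i` is three times continuously differentiable on a neighbourhood of the path
    (U : Set (V1 × V2)) (hU : IsOpen U)
    (hpath : ∀ t ∈ Set.Icc (0 : ℝ) T, (X1 t, X2 t) ∈ U)
    (hF : ∀ i ≤ n, ContDiffOn ℝ 3 (F i) U)
    -- the `q i` are bounded
    (hq : ∀ i ≤ n, ∃ C : ℝ, ∀ t ∈ Set.Icc (0 : ℝ) T, |q i t| ≤ C)
    -- first-order neutrality in every direction of `V1` and of `V2`
    (hfirst1 : ∀ t ∈ Set.Ico (0 : ℝ) T, ∀ v : V1,
      ∑ i ∈ Finset.range (n + 1),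
        q i t * fderiv ℝ (F i) (X1 t, X2 t) (v, (0 : V2)) = 0)
    (hfirst2 : ∀ t ∈ Set.Ico (0 : ℝ) T, ∀ v : V2,
      ∑ i ∈ Finset.range (n + 1),
        q i t * fderiv ℝ (F i) (X1 t, X2 t) ((0 : V1), v) = 0)
    -- second-order neutrality in all directions of `V2`
    (hsecond : ∀ t ∈ Set.Ico (0 : ℝ) T, ∀ v1 v2 : V2,
      ∑ i ∈ Finset.range (n + 1),
        q i t * fderiv ℝ (fun x => fderiv ℝ (F i) x ((0 : V1), v2)) (X1 t, X2 t)
          ((0 : V1), v1) = 0) :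
    Tendsto (fun N => ∑ k ∈ Finset.range (π.c N), ∑ i ∈ Finset.range (n + 1),
      q i (π.t N k) *
        (F i (X1 (π.t N (k + 1)), X2 (π.t N (k + 1))) - F i (X1 (π.t N k), X2 (π.t N k))))
      atTop (nhds 0) := by
  set X : ℝ → V1 × V2 := fun t => (X1 t, X2 t)
  have hXc : ContinuousOn X (Set.Icc 0 T) := hX1c.prodMk hX2c
  have hsmooth (i : ℕ) (hi : i ≤ n) (x) (hx : x ∈ X '' Set.Icc 0 T) : ContDiffAt ℝ 3 (F i) x := by
    obtain ⟨t, ht, rfl⟩ := hx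
    exact (hF i hi).contDiffAt (hU.mem_nhds (hpath t ht))
  have hterm (i : ℕ) (hi : i ∈ Finset.range (n + 1)) : ∃ C, ∀ᶠ N in atTop, ∀ k < π.c N,
      |q i (π.t N k) * (F i (X (π.t N (k + 1))) - F i (X (π.t N k)) -
        (fderiv ℝ (F i) (X (π.t N k)) (X (π.t N (k + 1)) - X (π.t N k)) +
          1 / 2 * fderiv ℝ (fderiv ℝ (F i)) (X (π.t N k))
            (0, (X (π.t N (k + 1)) - X (π.t N k)).2) (0, (X (π.t N (k + 1)) - X (π.t N k)).2)))|
      ≤ C * (‖X1 (π.t N (k + 1)) - X1 (π.t N k)‖ ^ p1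
        + ‖X2 (π.t N (k + 1)) - X2 (π.t N k)‖ ^ p2) := by
    have hi' : i ≤ n := Nat.lt_succ_iff.mp (Finset.mem_range.mp hi)
    obtain ⟨Q, hQ⟩ := hq i hi'
    obtain ⟨C, hC0, δ, hδ, hC⟩ := (isCompact_Icc.image_of_continuousOn hXc).exists_abs_taylor_snd_le
      hp1 hp1' hp2 hp2' hp (hsmooth i hi')
    refine ⟨Q * C, ?_⟩
    filter_upwards [π.eventually_norm_sub_lt hXc hδ] with N hN k hk
    have ht := π.t_mem_Icc hk.le
    have := hC _ (Set.mem_image_of_mem X ht) _ (hN k hk)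
    rw [abs_mul, mul_assoc]
    exact mul_le_mul (hQ _ ht) this (abs_nonneg _) ((abs_nonneg _).trans (hQ _ ht))
  choose! C hC using hterm
  have hneutral (t : ℝ) (ht : t ∈ Set.Ico 0 T) (h : V1 × V2) :
      ∑ i ∈ Finset.range (n + 1), q i t * (fderiv ℝ (F i) (X t) h +
        1 / 2 * fderiv ℝ (fderiv ℝ (F i)) (X t) (0, h.2) (0, h.2)) = 0 := by
    have hsnd (i : ℕ) (hi : i ∈ Finset.range (n + 1)) :
        fderiv ℝ (fun x => fderiv ℝ (F i) x ((0 : V1), h.2)) (X t) (0, h.2) =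
          fderiv ℝ (fderiv ℝ (F i)) (X t) (0, h.2) (0, h.2) := by
      have hd : DifferentiableAt ℝ (fderiv ℝ (F i)) (X t) :=
        ((hsmooth i (Nat.lt_succ_iff.mp (Finset.mem_range.mp hi)) _
          (Set.mem_image_of_mem X (Set.Ico_subset_Icc_self ht))).fderiv_right (m := 2)
            (by norm_num)).differentiableAt (by simp)
      rw [fderiv_clm_apply hd (differentiableAt_const _)]
      simp
    calc _ = ∑ i ∈ Finset.range (n + 1), (q i t * fderiv ℝ (F i) (X t) (h.1, 0) +
          q i t * fderiv ℝ (F i) (X t) (0, h.2) + 1 / 2 * (q i t *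
            fderiv ℝ (fun x => fderiv ℝ (F i) x ((0 : V1), h.2)) (X t) (0, h.2))) := by
          refine Finset.sum_congr rfl fun i hi => ?_
          have hdecomp : fderiv ℝ (F i) (X t) h =
              fderiv ℝ (F i) (X t) (h.1, 0) + fderiv ℝ (F i) (X t) (0, h.2) := by
            rw [← map_add]; simp
          rw [hsnd i hi, hdecomp]
          ring
      _ = 0 := by
          rw [Finset.sum_add_distrib, Finset.sum_add_distrib, ← Finset.mul_sum,
            hfirst1 t ht, hfirst2 t ht, hsecond t ht]
          simp
  refine squeeze_zero_norm' (a := fun N => (∑ i ∈ Finset.range (n + 1), C i) *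
    (∑ k ∈ Finset.range (π.c N), ‖X1 (π.t N (k + 1)) - X1 (π.t N k)‖ ^ p1 +
      ∑ k ∈ Finset.range (π.c N), ‖X2 (π.t N (k + 1)) - X2 (π.t N k)‖ ^ p2)) ?_ ?_
  · filter_upwards [(Filter.eventually_all_finset _).mpr hC] with N hN
    rw [← Finset.sum_add_distrib, Finset.mul_sum]
    refine norm_sum_le_of_le _ fun k hk => ?_
    have hk' := Finset.mem_range.mp hk
    have hsub := hneutral _ (π.t_mem_Ico hk') (X (π.t N (k + 1)) - X (π.t N k))
    rw [← sub_zero (∑ i ∈ Finset.range (n + 1), _), ← hsub, ← Finset.sum_sub_distrib,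
      Finset.sum_mul]
    refine norm_sum_le_of_le _ fun i hi => ?_
    rw [← mul_sub]
    exact hN i hi k hk'
  · simpa using (hX1.add hX2).const_mul (∑ i ∈ Finset.range (n + 1), C i)
end

section
/- (Pathwise convergence of the gamma-hedging strategy in the Black–Scholes model.) Let T > 0, σ > 0, and let π = (π_N) be a sequence of partitions of [0,T] with mesh tending to 0. Let X : [0,T] → ℝ be a continuous path with vanishing p-th variation along π for some p ≤ 3. For i = 0,…,n let F^i : [0,T] × ℝ → ℝ be three times continuously differentiable on a neighbourhood of the path {(t, X_t) : t ∈ [0,T]} and satisfy the Black–Scholes PDE with zero interest rate along the path: ∂F^i/∂t (t, X_t) + (1/2) σ² X_t² ∂²F^i/∂s² (t, X_t) = 0 for all t ∈ [0,T). Let q^i : [0,T] → ℝ (i = 0,…,n) be bounded functions with q^0 ≡ −1 satisfying, for all t ∈ [0,T): Σ_{i=0}^n q^i_t ∂F^i/∂s (t, X_t) = 0 (delta neutrality) and Σ_{i=0}^n q^i_t ∂²F^i/∂s² (t, X_t) = 0 (gamma neutrality). Then F^0(T, X_T) = F^0(0, X_0) + lim_{N→∞} Σ_{[u,v]∈π_N}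 Σ_{i=1}^n q^i_u ( F^i(v, X_v) − F^i(u, X_u) ). In particular, if F^0(T, s) = f^0(s) for a payoff function f^0 then f^0(X_T) = F^0(0, X_0) + lim_{N→∞} Σ_{[u,v]∈π_N} Σ_{i=1}^n q^i_u ( F^i(v, X_v) − F^i(u, X_u) ). -/
open Filter Topology

/-- A second-order Taylor estimate for a real function with a bounded third derivative. -/
theorem abs_taylor_two_le {g g₁ g₂ g₃ : ℝ → ℝ} {x y C : ℝ}
    (h₀ : ∀ z ∈ Set.uIcc x y, HasDerivAt g (g₁ z) z)
    (h₁ : ∀ z ∈ Set.uIcc x y, HasDerivAt g₁ (g₂ z) z)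
    (h₂ : ∀ z ∈ Set.uIcc x y, HasDerivAt g₂ (g₃ z) z)
    (h₃ : ∀ z ∈ Set.uIcc x y, |g₃ z| ≤ C) :
    |g y - g x - g₁ x * (y - x) - 1 / 2 * g₂ x * (y - x) ^ 2| ≤ C * |y - x| ^ 3 := by
  have hC : 0 ≤ C := (abs_nonneg _).trans (h₃ x Set.left_mem_uIcc)
  have hconv : Convex ℝ (Set.uIcc x y) := convex_uIcc x y
  have hdist : ∀ z ∈ Set.uIcc x y, |z - x| ≤ |y - x| := fun z hz =>
    Set.abs_sub_left_of_mem_uIcc hz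
  have b₂ : ∀ z ∈ Set.uIcc x y, |g₂ z - g₂ x| ≤ C * |y - x| := fun z hz =>
    (hconv.norm_image_sub_le_of_norm_hasDerivWithin_le
      (fun w hw => (h₂ w hw).hasDerivWithinAt) h₃ Set.left_mem_uIcc hz).trans
      (mul_le_mul_of_nonneg_left (hdist z hz) hC)
  have b₁ : ∀ z ∈ Set.uIcc x y, |g₁ z - g₁ x - g₂ x * (z - x)| ≤ C * |y - x| * |y - x| := by
    intro z hz
    have hd : ∀ w ∈ Set.uIcc x y, HasDerivWithinAt (fun w => g₁ w - g₁ x - g₂ x * (w - x))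
        (g₂ w - g₂ x) (Set.uIcc x y) w := fun w hw => by
      have := ((h₁ w hw).sub_const (g₁ x)).sub
        (((hasDerivAt_id w).sub_const x).const_mul (g₂ x))
      exact (this.congr_deriv (by rw [mul_one])).hasDerivWithinAt
    have := hconv.norm_image_sub_le_of_norm_hasDerivWithin_le hd b₂ Set.left_mem_uIcc hz
    simp only [sub_self, mul_zero, sub_zero, Real.norm_eq_abs] at this
    exact this.trans (mul_le_mul_of_nonneg_left (hdist z hz) (by positivity))
  have hd : ∀ w ∈ Set.uIcc x y,
      HasDerivWithinAt (fun w => g w - g x - g₁ x * (w - x) - 1 / 2 * g₂ x * (w - x) ^ 2)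
        (g₁ w - g₁ x - g₂ x * (w - x)) (Set.uIcc x y) w := fun w hw => by
    have hl := (hasDerivAt_id w).sub_const x
    have := (((h₀ w hw).sub_const (g x)).sub (hl.const_mul (g₁ x))).sub
      ((hl.pow 2).const_mul (1 / 2 * g₂ x))
    refine HasDerivAt.hasDerivWithinAt (this.congr_deriv ?_)
    simp only [id]
    push_cast
    ring
  have := hconv.norm_image_sub_le_of_norm_hasDerivWithin_le hd b₁
    Set.left_mem_uIcc Set.right_mem_uIcc
  simp only [sub_self, mul_zero, sub_zero, Real.norm_eq_abs, ne_eq, OfNat.ofNat_ne_zero,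
    not_false_eq_true, zero_pow] at this
  exact this.trans_eq (by ring)

/-- The remainder after the expansion of `F` to first order in time and second order in space
between the points `a` and `b`. -/
noncomputable def itoRemainder (F : ℝ × ℝ → ℝ) (a b : ℝ × ℝ) : ℝ :=
  F b - F a - fderiv ℝ F a (1, 0) * (b.1 - a.1) - fderiv ℝ F a (0, 1) * (b.2 - a.2) -
    1 / 2 * fderiv ℝ (fun z => fderiv ℝ F z (0, 1)) a (0, 1) * (b.2 - a.2) ^ 2

theorem ContDiffOn.fderiv_apply_const {F : ℝ × ℝ → ℝ} {U : Set (ℝ × ℝ)} {m n : WithTop ℕ∞}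
    (hF : ContDiffOn ℝ n F U) (hU : IsOpen U) (hmn : m + 1 ≤ n) (e : ℝ × ℝ) :
    ContDiffOn ℝ m (fun z => fderiv ℝ F z e) U :=
  (hF.fderiv_of_isOpen hU hmn).clm_apply contDiffOn_const

theorem hasDerivAt_comp_prodMk_left {F : ℝ × ℝ → ℝ} {u z : ℝ}
    (h : DifferentiableAt ℝ F (u, z)) :
    HasDerivAt (fun w => F (u, w)) (fderiv ℝ F (u, z) (0, 1)) z :=
  h.hasFDerivAt.comp_hasDerivAt z ((hasDerivAt_const z u).prodMk (hasDerivAt_id z))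

theorem hasDerivAt_comp_prodMk_right {F : ℝ × ℝ → ℝ} {u z : ℝ}
    (h : DifferentiableAt ℝ F (u, z)) :
    HasDerivAt (fun w => F (w, z)) (fderiv ℝ F (u, z) (1, 0)) u :=
  h.hasFDerivAt.comp_hasDerivAt u ((hasDerivAt_id u).prodMk (hasDerivAt_const u z))

theorem exists_abs_itoRemainder_le {F : ℝ × ℝ → ℝ} {U K : Set (ℝ × ℝ)} (hU : IsOpen U)
    (hK : IsCompact K) (hKU : K ⊆ U) (hF : ContDiffOn ℝ 3 F U) :
    ∃ C, 0 ≤ C ∧ ∀ ε > 0, ∃ δ > 0, ∀ a ∈ K, ∀ b, dist b a < δ →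
      |itoRemainder F a b| ≤ C * |b.2 - a.2| ^ 3 + ε * |b.1 - a.1| := by
  obtain ⟨r, hr, hrU⟩ := hK.exists_cthickening_subset_open hU hKU
  have hK' : IsCompact (Metric.cthickening r K) := hK.cthickening
  have hdiff : ∀ {G : ℝ × ℝ → ℝ} {m : WithTop ℕ∞}, ContDiffOn ℝ m G U → m ≠ 0 →
      ∀ z ∈ Metric.cthickening r K, DifferentiableAt ℝ G z := fun hG hm z hz =>
    (hG.differentiableOn hm).differentiableAt (hU.mem_nhds (hrU hz))
  have hFt : ContDiffOn ℝ 2 (fun z => fderiv ℝ F z (1, 0)) U :=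
    hF.fderiv_apply_const hU (by norm_num) _
  have hFs : ContDiffOn ℝ 2 (fun z => fderiv ℝ F z (0, 1)) U :=
    hF.fderiv_apply_const hU (by norm_num) _
  have hFss : ContDiffOn ℝ 1 (fun z => fderiv ℝ (fun z => fderiv ℝ F z (0, 1)) z (0, 1)) U :=
    hFs.fderiv_apply_const hU (by norm_num) _
  have hFsss := hFss.fderiv_apply_const (m := 0) hU (by norm_num) (0, 1)
  obtain ⟨C, hC⟩ := hK'.exists_bound_of_continuousOn (hFsss.continuousOn.mono hrU)
  refine ⟨max C 0, le_max_right _ _, fun ε hε => ?_⟩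
  have huc := hK'.uniformContinuousOn_of_continuous (hFt.continuousOn.mono hrU)
  obtain ⟨δ, hδ, hδF⟩ := Metric.uniformContinuousOn_iff.1 huc ε hε
  refine ⟨min δ r, lt_min hδ hr, ?_⟩
  rintro ⟨u, x⟩ ha ⟨v, y⟩ hb
  rw [Prod.dist_eq, max_lt_iff] at hb
  obtain ⟨hvu, hyx⟩ := hb
  simp only [Real.dist_eq] at hvu hyx
  have hclose : ∀ w ∈ Set.uIcc u v, ∀ z ∈ Set.uIcc x y, dist (w, z) (u, x) < min δ r :=
    fun w hw z hz => by
      rw [Prod.dist_eq, max_lt_iff]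
      exact ⟨(Set.abs_sub_left_of_mem_uIcc hw).trans_lt hvu,
        (Set.abs_sub_left_of_mem_uIcc hz).trans_lt hyx⟩
  have hmem : ∀ w ∈ Set.uIcc u v, ∀ z ∈ Set.uIcc x y, (w, z) ∈ Metric.cthickening r K :=
    fun w hw z hz => Metric.mem_cthickening_of_dist_le _ (u, x) _ _ ha
      ((hclose w hw z hz).le.trans (min_le_right _ _))
  have hspace := abs_taylor_two_le (x := x) (y := y)
    (fun z hz => hasDerivAt_comp_prodMk_left
      (hdiff hF (by norm_num) _ (hmem u Set.left_mem_uIcc z hz)))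
    (fun z hz => hasDerivAt_comp_prodMk_left
      (hdiff hFs (by norm_num) _ (hmem u Set.left_mem_uIcc z hz)))
    (fun z hz => hasDerivAt_comp_prodMk_left
      (hdiff hFss (by norm_num) _ (hmem u Set.left_mem_uIcc z hz)))
    (fun z hz => (hC _ (hmem u Set.left_mem_uIcc z hz)).trans (le_max_left _ (0 : ℝ)))
  have htime : |F (v, y) - F (u, y) - fderiv ℝ F (u, x) (1, 0) * (v - u)| ≤ ε * |v - u| := by
    have hd : ∀ w ∈ Set.uIcc u v,
        HasDerivWithinAt (fun w => F (w, y) - fderiv ℝ F (u, x) (1, 0) * (w - u))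
          (fderiv ℝ F (w, y) (1, 0) - fderiv ℝ F (u, x) (1, 0)) (Set.uIcc u v) w :=
      fun w hw => by
        have := (hasDerivAt_comp_prodMk_right
          (hdiff hF (by norm_num) _ (hmem w hw y Set.right_mem_uIcc))).sub
          (((hasDerivAt_id w).sub_const u).const_mul (fderiv ℝ F (u, x) (1, 0)))
        exact (this.congr_deriv (by rw [mul_one])).hasDerivWithinAt
    have hbound : ∀ w ∈ Set.uIcc u v,
        ‖fderiv ℝ F (w, y) (1, 0) - fderiv ℝ F (u, x) (1, 0)‖ ≤ ε := fun w hw =>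
      (hδF _ (hmem w hw y Set.right_mem_uIcc) _
        (hmem u Set.left_mem_uIcc x Set.left_mem_uIcc)
        ((hclose w hw y Set.right_mem_uIcc).trans_le (min_le_left _ _))).le
    have := (convex_uIcc u v).norm_image_sub_le_of_norm_hasDerivWithin_le hd hbound
      Set.left_mem_uIcc Set.right_mem_uIcc
    simp only [sub_self, mul_zero, sub_zero, Real.norm_eq_abs] at this
    rwa [sub_right_comm] at this
  have hsplit : itoRemainder F (u, x) (v, y) =
      (F (u, y) - F (u, x) - fderiv ℝ F (u, x) (0, 1) * (y - x) -
        1 / 2 * fderiv ℝ (fun z => fderiv ℝ F z (0, 1)) (u, x) (0, 1) * (y - x) ^ 2) +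
      (F (v, y) - F (u, y) - fderiv ℝ F (u, x) (1, 0) * (v - u)) := by
    simp only [itoRemainder]
    ring
  rw [hsplit]
  exact (abs_add_le _ _).trans (add_le_add hspace htime)

namespace PartitionSeq

variable {T : ℝ} (π : PartitionSeq T)

theorem t_monotone {N i j : ℕ} (hij : i ≤ j) (hj : j ≤ π.c N) : π.t N i ≤ π.t N j := by
  induction j, hij using Nat.le_induction with
  | base => exact le_rfl
  | succ j _ ih => exact (ih (by omega)).trans (π.mono N j (by omega)).le

theorem eventually_dist_path_lt {E : Type*} [PseudoMetricSpace E] {Y : ℝ → E}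
    (hY : ContinuousOn Y (Set.Icc 0 T)) {δ : ℝ} (hδ : 0 < δ) :
    ∀ᶠ N in atTop, ∀ k < π.c N, dist (Y (π.t N (k + 1))) (Y (π.t N k)) < δ := by
  obtain ⟨η, hη, h⟩ := Metric.uniformContinuousOn_iff.1
    (isCompact_Icc.uniformContinuousOn_of_continuous hY) δ hδ
  obtain ⟨M, hM⟩ := π.mesh_to_zero η hη
  filter_upwards [eventually_ge_atTop M] with N hN k hk
  refine h _ (π.t_mem_Icc hk) _ (π.t_mem_Icc hk.le) ?_
  rw [Real.dist_eq, abs_of_pos (sub_pos.2 (π.mono N k hk))]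
  exact hM N hN k hk

end PartitionSeq

theorem VanishingVariation.tendsto_sum_abs_pow_three {T p : ℝ} {π : PartitionSeq T} {X : ℝ → ℝ}
    (hp : p ≤ 3) (hXc : ContinuousOn X (Set.Icc 0 T)) (hX : VanishingVariation π p X) :
    Tendsto (fun N => ∑ k ∈ Finset.range (π.c N),
      |X (π.t N (k + 1)) - X (π.t N k)| ^ 3) atTop (𝓝 0) := by
  refine squeeze_zero' (Eventually.of_forall fun N => by positivity) ?_ hX
  filter_upwards [π.eventually_dist_path_lt hXc one_pos] with N hN
  refine Finset.sum_le_sum fun k hk => ?_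
  have hlt := hN k (Finset.mem_range.1 hk)
  rw [Real.dist_eq] at hlt
  rw [Real.norm_eq_abs]
  rcases (abs_nonneg (X (π.t N (k + 1)) - X (π.t N k))).eq_or_lt with h | h
  · rw [← h]
    simpa using Real.rpow_nonneg le_rfl p
  · have := Real.rpow_le_rpow_of_exponent_ge h hlt.le hp
    exact_mod_cast this

theorem tendsto_sum_mul_itoRemainder {T p : ℝ} {π : PartitionSeq T} {X : ℝ → ℝ}
    (hT : 0 ≤ T) (hp : p ≤ 3) (hXc : ContinuousOn X (Set.Icc 0 T))
    (hX : VanishingVariation π p X) {U : Set (ℝ × ℝ)} (hU : IsOpen U)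
    (hpath : ∀ t ∈ Set.Icc (0 : ℝ) T, (t, X t) ∈ U) {F : ℝ × ℝ → ℝ} (hF : ContDiffOn ℝ 3 F U)
    {q : ℝ → ℝ} (hq : ∃ C : ℝ, ∀ t ∈ Set.Icc (0 : ℝ) T, |q t| ≤ C) :
    Tendsto (fun N => ∑ k ∈ Finset.range (π.c N), q (π.t N k) *
      itoRemainder F (π.t N k, X (π.t N k)) (π.t N (k + 1), X (π.t N (k + 1)))) atTop (𝓝 0) := by
  have hY : ContinuousOn (fun t => (t, X t)) (Set.Icc 0 T) := continuousOn_id.prodMk hXc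
  have hKU : (fun t => (t, X t)) '' Set.Icc 0 T ⊆ U := by
    rintro _ ⟨t, ht, rfl⟩
    exact hpath t ht
  obtain ⟨C, hC, hrem⟩ := exists_abs_itoRemainder_le hU (isCompact_Icc.image_of_continuousOn hY)
    hKU hF
  obtain ⟨Q, hQ⟩ := hq
  have hQ0 : 0 ≤ Q := (abs_nonneg _).trans (hQ 0 ⟨le_rfl, hT⟩)
  have hlim := ((hX.tendsto_sum_abs_pow_three hp hXc).const_mul C).const_mul Q
  simp only [mul_zero] at hlim
  rw [Metric.tendsto_nhds]
  intro ε hε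
  have hε' : 0 < ε / (2 * (Q * T + 1)) := by positivity
  obtain ⟨δ, hδ, hδF⟩ := hrem _ hε'
  filter_upwards [π.eventually_dist_path_lt hY hδ,
    hlim.eventually (gt_mem_nhds (half_pos hε))] with N hN hsmall
  rw [Real.dist_eq, sub_zero]
  have htel : ∑ k ∈ Finset.range (π.c N), (π.t N (k + 1) - π.t N k) = T := by
    rw [Finset.sum_range_sub, π.last, π.first, sub_zero]
  calc |∑ k ∈ Finset.range (π.c N), q (π.t N k) *
      itoRemainder F (π.t N k, X (π.t N k)) (π.t N (k + 1), X (π.t N (k + 1)))|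
      ≤ ∑ k ∈ Finset.range (π.c N), Q * (C * |X (π.t N (k + 1)) - X (π.t N k)| ^ 3 +
          ε / (2 * (Q * T + 1)) * (π.t N (k + 1) - π.t N k)) := by
        refine (Finset.abs_sum_le_sum_abs _ _).trans (Finset.sum_le_sum fun k hk => ?_)
        have hk := Finset.mem_range.1 hk
        rw [abs_mul, ← abs_of_pos (sub_pos.2 (π.mono N k hk))]
        exact mul_le_mul (hQ _ (π.t_mem_Icc hk.le))
          (hδF _ ⟨_, π.t_mem_Icc hk.le, rfl⟩ _ (hN k hk)) (abs_nonneg _) hQ0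
    _ = Q * (C * ∑ k ∈ Finset.range (π.c N), |X (π.t N (k + 1)) - X (π.t N k)| ^ 3) +
          Q * T * (ε / (2 * (Q * T + 1))) := by
        rw [← Finset.mul_sum, Finset.sum_add_distrib, ← Finset.mul_sum, ← Finset.mul_sum, htel]
        ring
    _ < ε / 2 + ε / 2 := by
        refine add_lt_add hsmall ?_
        have : 0 ≤ Q * T := by positivity
        rw [mul_div_assoc', div_lt_div_iff₀ (by positivity) two_pos]
        nlinarith
    _ = ε := add_halves ε

/-- Corollary: pathwise convergence of the gamma-hedging strategy in the
Black–Scholes model (zero interest rate). -/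
theorem gamma_hedging_black_scholes
    (T : ℝ) (hT : 0 < T) (σ : ℝ) (hσ : 0 < σ) (π : PartitionSeq T)
    (p : ℝ) (hp : 1 ≤ p) (hp' : p ≤ 3)
    (X : ℝ → ℝ) (hXc : ContinuousOn X (Set.Icc 0 T))
    (hX : VanishingVariation π p X)
    (n : ℕ) (F : ℕ → ℝ × ℝ → ℝ) (q : ℕ → ℝ → ℝ)
    -- each `F i` is three times continuously differentiable on a neighbourhood of the path
    (U : Set (ℝ × ℝ)) (hU : IsOpen U)
    (hpath : ∀ t ∈ Set.Icc (0 : ℝ) T, (t, X t) ∈ U)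
    (hF : ∀ i ≤ n, ContDiffOn ℝ 3 (F i) U)
    -- the Black–Scholes PDE with zero interest rate, along the path
    (hBS : ∀ i ≤ n, ∀ t ∈ Set.Ico (0 : ℝ) T,
      fderiv ℝ (F i) (t, X t) ((1 : ℝ), (0 : ℝ)) +
        (1 / 2) * σ ^ 2 * (X t) ^ 2 *
          fderiv ℝ (fun z => fderiv ℝ (F i) z ((0 : ℝ), (1 : ℝ))) (t, X t)
            ((0 : ℝ), (1 : ℝ)) = 0)
    -- the `q i` are bounded, with a unit short position in the target option
    (hq : ∀ i ≤ n, ∃ C : ℝ, ∀ t ∈ Set.Icc (0 : ℝ) T, |q i t| ≤ C)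
    (hq0 : ∀ t, q 0 t = -1)
    -- delta neutrality
    (hdelta : ∀ t ∈ Set.Ico (0 : ℝ) T,
      ∑ i ∈ Finset.range (n + 1),
        q i t * fderiv ℝ (F i) (t, X t) ((0 : ℝ), (1 : ℝ)) = 0)
    -- gamma neutrality
    (hgamma : ∀ t ∈ Set.Ico (0 : ℝ) T,
      ∑ i ∈ Finset.range (n + 1),
        q i t * fderiv ℝ (fun z => fderiv ℝ (F i) z ((0 : ℝ), (1 : ℝ))) (t, X t)
          ((0 : ℝ), (1 : ℝ)) = 0)
    -- `f0` is the payoff of the replicated option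
    (f0 : ℝ → ℝ) (hf0 : ∀ s : ℝ, F 0 (T, s) = f0 s) :
    Tendsto (fun N => ∑ k ∈ Finset.range (π.c N), ∑ i ∈ Finset.Icc 1 n,
        q i (π.t N k) * (F i (π.t N (k + 1), X (π.t N (k + 1))) - F i (π.t N k, X (π.t N k))))
      atTop (nhds (F 0 (T, X T) - F 0 (0, X 0))) ∧
    Tendsto (fun N => ∑ k ∈ Finset.range (π.c N), ∑ i ∈ Finset.Icc 1 n,
        q i (π.t N k) * (F i (π.t N (k + 1), X (π.t N (k + 1))) - F i (π.t N k, X (π.t N k))))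
      atTop (nhds (f0 (X T) - F 0 (0, X 0))) := by
  have hrem := tendsto_finsetSum (Finset.range (n + 1)) fun i hi =>
    tendsto_sum_mul_itoRemainder hT.le hp' hXc hX hU hpath
      (hF i (Finset.mem_range_succ_iff.1 hi)) (hq i (Finset.mem_range_succ_iff.1 hi))
  have hstep : ∀ N, ∀ k < π.c N, ∑ i ∈ Finset.Icc 1 n, q i (π.t N k) *
      (F i (π.t N (k + 1), X (π.t N (k + 1))) - F i (π.t N k, X (π.t N k))) =
      ∑ i ∈ Finset.range (n + 1), q i (π.t N k) *
        itoRemainder (F i) (π.t N k, X (π.t N k)) (π.t N (k + 1), X (π.t N (k + 1))) +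
      (F 0 (π.t N (k + 1), X (π.t N (k + 1))) - F 0 (π.t N k, X (π.t N k))) := by
    intro N k hk
    have ht := π.t_mem_Ico hk
    have hd := hdelta _ ht
    have hg := hgamma _ ht
    generalize π.t N k = u at *
    generalize π.t N (k + 1) = v
    have hexp : ∑ i ∈ Finset.range (n + 1), q i u * itoRemainder (F i) (u, X u) (v, X v) =
        ∑ i ∈ Finset.range (n + 1), q i u * (F i (v, X v) - F i (u, X u)) -
        (X v - X u) * ∑ i ∈ Finset.range (n + 1), q i u * fderiv ℝ (F i) (u, X u) (0, 1) +
        (1 / 2 * σ ^ 2 * X u ^ 2 * (v - u) - 1 / 2 * (X v - X u) ^ 2) *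
          ∑ i ∈ Finset.range (n + 1), q i u *
            fderiv ℝ (fun z => fderiv ℝ (F i) z (0, 1)) (u, X u) (0, 1) := by
      rw [Finset.mul_sum, Finset.mul_sum, ← Finset.sum_sub_distrib, ← Finset.sum_add_distrib]
      refine Finset.sum_congr rfl fun i hi => ?_
      have := hBS i (Finset.mem_range_succ_iff.1 hi) u ht
      simp only [itoRemainder]
      linear_combination -(q i u * (v - u)) * this
    rw [hexp, hd, hg, mul_zero, mul_zero, Finset.range_eq_Ico,
      Finset.sum_eq_sum_Ico_succ_bot n.succ_pos, hq0, zero_add, Nat.succ_eq_add_one, Finset.Ico_add_one_right_eq_Icc]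
    ring
  have hmain : Tendsto (fun N => ∑ k ∈ Finset.range (π.c N), ∑ i ∈ Finset.Icc 1 n,
      q i (π.t N k) * (F i (π.t N (k + 1), X (π.t N (k + 1))) - F i (π.t N k, X (π.t N k))))
      atTop (nhds (F 0 (T, X T) - F 0 (0, X 0))) := by
    have hlim := hrem.add_const (F 0 (T, X T) - F 0 (0, X 0))
    rw [Finset.sum_const_zero, zero_add] at hlim
    refine hlim.congr fun N => ?_
    rw [Finset.sum_congr rfl fun k hk => hstep N k (Finset.mem_range.1 hk),
      Finset.sum_add_distrib, Finset.sum_comm,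
      Finset.sum_range_sub (fun k => F 0 (π.t N k, X (π.t N k))), π.last, π.first]
  exact ⟨hmain, hf0 (X T) ▸ hmain⟩
end

section
/- Let T > 0 and let π = (π_N) be a sequence of partitions of [0,T] with mesh tending to 0, and let X : [0,T] → ℝ be a continuous path. The following are equivalent: (a) the finite measures μ_N := Σ_{[u,v]∈π_N} (X_v − X_u)² δ_u on [0,T] converge weakly to a finite measure μ without atoms; (b) there exists a continuous function [X] : [0,T] → ℝ such that for every t ∈ [0,T], Σ_{[u,v]∈π_N, u≤t} (X_v − X_u)² → [X]_t as N → ∞. Moreover, when these hold, μ([0,t]) = [X]_t for all t ∈ [0,T]. -/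
open Filter Topology

open MeasureTheory

/-- The discrete measure `μ_N = Σ_{[u,v] ∈ π_N} (X_v - X_u)² δ_u` on `ℝ`. -/
noncomputable def quadMeasure {T : ℝ} (π : PartitionSeq T) (X : ℝ → ℝ) (N : ℕ) :
    Measure ℝ :=
  ∑ i ∈ Finset.range (π.c N),
    (ENNReal.ofReal ((X (π.t N (i + 1)) - X (π.t N i)) ^ 2)) • Measure.dirac (π.t N i)

/-- A weakly convergent family of finite measures converges on every set whose frontier is null
for the limit. -/
theorem MeasureTheory.FiniteMeasure.tendsto_measure_of_null_frontier_of_tendsto_nhds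
    {Ω ι : Type*} {L : Filter ι} [MeasurableSpace Ω] [TopologicalSpace Ω] [OpensMeasurableSpace Ω]
    [HasOuterApproxClosed Ω] {μ : FiniteMeasure Ω} {μs : ι → FiniteMeasure Ω}
    (h : Tendsto μs L (𝓝 μ)) {E : Set Ω} (hE : μ (frontier E) = 0) :
    Tendsto (fun i => μs i E) L (𝓝 (μ E)) := by
  rcases isEmpty_or_nonempty Ω with hΩ | hΩ
  · have hempty : ∀ ν : FiniteMeasure Ω, ν E = 0 := fun ν => by
      rw [FiniteMeasure.null_iff_toMeasure_null, Set.eq_empty_of_isEmpty E, measure_empty]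
    simpa only [hempty] using tendsto_const_nhds
  by_cases hμ : μ = 0
  · subst hμ
    have hmass := h.mass
    simp only [FiniteMeasure.zero_mass] at hmass
    simpa using tendsto_of_tendsto_of_tendsto_of_le_of_le tendsto_const_nhds hmass
      (fun i => zero_le (a := μs i E)) (fun i => (μs i).apply_le_mass E)
  · simp only [FiniteMeasure.self_eq_mass_mul_normalize _ E]
    refine h.mass.mul (ProbabilityMeasure.tendsto_measure_of_null_frontier_of_tendsto
      (FiniteMeasure.tendsto_normalize_of_tendsto h hμ) ?_)
    rw [FiniteMeasure.normalize_eq_of_nonzero _ hμ, hE, mul_zero]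

/-- Finite measures on `ℝ` whose total masses and distribution functions converge to those of a
finite measure converge weakly. -/
theorem MeasureTheory.FiniteMeasure.tendsto_of_tendsto_measure_Iic
    {ι : Type*} {L : Filter ι} [L.IsCountablyGenerated]
    {μ : FiniteMeasure ℝ} {μs : ι → FiniteMeasure ℝ}
    (hmass : Tendsto (fun i => (μs i).mass) L (𝓝 μ.mass))
    (h : ∀ x, Tendsto (fun i => μs i (Set.Iic x)) L (𝓝 (μ (Set.Iic x)))) :
    Tendsto μs L (𝓝 μ) := by
  by_cases hμ : μ = 0
  · subst hμ
    exact FiniteMeasure.tendsto_zero_of_tendsto_zero_mass (by simpa using hmass)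
  refine FiniteMeasure.tendsto_of_tendsto_normalize_testAgainstNN_of_tendsto_mass ?_ hmass
  have hμ' : μ.mass ≠ 0 := μ.mass_nonzero_iff.2 hμ
  have hne : ∀ᶠ i in L, μs i ≠ 0 := by
    filter_upwards [hmass.eventually_ne hμ'] with i hi
    exact (μs i).mass_nonzero_iff.1 hi
  refine (isPiSystem_Ioc (id : ℝ → ℝ) id).tendsto_probabilityMeasure_of_tendsto_of_mem ?_ ?_ ?_
  · rintro _ ⟨a, b, -, rfl⟩
    exact measurableSet_Ioc
  · intro u hu x hx
    obtain ⟨ε, hε, hball⟩ := Metric.isOpen_iff.1 hu x hx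
    refine ⟨Set.Ioc (x - ε / 2) (x + ε / 2), ⟨_, _, by simp; linarith, rfl⟩,
      Ioc_mem_nhds (by linarith) (by linarith), fun y hy => hball ?_⟩
    rw [Metric.mem_ball, Real.dist_eq, abs_lt]
    constructor <;> linarith [hy.1, hy.2]
  · rintro _ ⟨a, b, hab, rfl⟩
    have hIoc : ∀ ν : FiniteMeasure ℝ, ν (Set.Ioc a b) = ν (Set.Iic b) - ν (Set.Iic a) := by
      intro ν
      have hunion : ν (Set.Iic b) = ν (Set.Iic a) + ν (Set.Ioc a b) := by
        have := measure_union (μ := (ν : Measure ℝ))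
          (Set.Iic_disjoint_Ioc (le_refl a) (c := b)) measurableSet_Ioc
        rw [Set.Iic_union_Ioc_eq_Iic (show a ≤ b from hab.le)] at this
        rw [← ENNReal.coe_inj]
        simpa only [ENNReal.coe_add, FiniteMeasure.ennreal_coeFn_eq_coeFn_toMeasure] using this
      rw [hunion, add_tsub_cancel_left]
    have key : Tendsto (fun i => (μs i).mass⁻¹ * (μs i) (Set.Ioc a b)) L
        (𝓝 (μ.mass⁻¹ * μ (Set.Ioc a b))) := by
      simp only [hIoc]
      exact (hmass.inv₀ hμ').mul ((h b).sub (h a))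
    rw [← FiniteMeasure.normalize_eq_of_nonzero _ hμ] at key
    refine key.congr' ?_
    filter_upwards [hne] with i hi
    exact (FiniteMeasure.normalize_eq_of_nonzero _ hi _).symm

namespace PartitionSeq

variable {T : ℝ} (π : PartitionSeq T)

theorem t_lt_t {N i j : ℕ} (hij : i < j) (hj : j ≤ π.c N) : π.t N i < π.t N j := by
  induction j, hij using Nat.le_induction with
  | base => exact π.mono N i hj
  | succ j _ ih => exact (ih (by omega)).trans (π.mono N j hj)

theorem t_nonneg {N i : ℕ} (hi : i ≤ π.c N) : 0 ≤ π.t N i := by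
  rcases Nat.eq_zero_or_pos i with rfl | h
  · exact (π.first N).ge
  · exact (π.first N).ge.trans (π.t_lt_t h hi).le

theorem t_lt_last {N i : ℕ} (hi : i < π.c N) : π.t N i < T :=
  (π.t_lt_t hi le_rfl).trans_eq (π.last N)

/-- The sum of the squared increments of `X` over the intervals of `π_N` starting at or
before `s`. -/
noncomputable def quadSum (X : ℝ → ℝ) (N : ℕ) (s : ℝ) : ℝ :=
  ∑ i ∈ (Finset.range (π.c N)).filter (fun i => π.t N i ≤ s),
    (X (π.t N (i + 1)) - X (π.t N i)) ^ 2

variable (X : ℝ → ℝ)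

theorem quadSum_mono (N : ℕ) : Monotone (π.quadSum X N) := fun _ _ h =>
  Finset.sum_le_sum_of_subset_of_nonneg
    (Finset.monotone_filter_right _ fun _ _ hi => le_trans hi h) fun _ _ _ => sq_nonneg _

theorem quadSum_nonneg (N : ℕ) (s : ℝ) : 0 ≤ π.quadSum X N s :=
  Finset.sum_nonneg fun _ _ => sq_nonneg _

theorem quadSum_of_neg (N : ℕ) {s : ℝ} (hs : s < 0) : π.quadSum X N s = 0 := by
  refine Finset.sum_eq_zero fun i hi => ?_
  simp only [Finset.mem_filter, Finset.mem_range] at hi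
  linarith [π.t_nonneg hi.1.le]

theorem quadSum_of_le (N : ℕ) {s : ℝ} (hs : T ≤ s) :
    π.quadSum X N s = ∑ i ∈ Finset.range (π.c N), (X (π.t N (i + 1)) - X (π.t N i)) ^ 2 := by
  rw [quadSum, Finset.filter_true_of_mem]
  intro i hi
  exact (π.t_lt_last (Finset.mem_range.1 hi)).le.trans hs

theorem quadSum_zero (N : ℕ) : π.quadSum X N 0 = (X (π.t N 1) - X 0) ^ 2 := by
  have : (Finset.range (π.c N)).filter (fun i => π.t N i ≤ 0) = {0} := by
    ext i
    simp only [Finset.mem_filter, Finset.mem_range, Finset.mem_singleton]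
    constructor
    · rintro ⟨hi, h0⟩
      by_contra hne
      have := π.t_lt_t (Nat.pos_of_ne_zero hne) hi.le
      rw [π.first] at this
      linarith
    · rintro rfl
      exact ⟨π.c_pos N, (π.first N).le⟩
  rw [quadSum, this, Finset.sum_singleton, π.first]

theorem tendsto_t_one : Tendsto (fun N => π.t N 1) atTop (𝓝 0) := by
  rw [Metric.tendsto_atTop]
  intro ε hε
  obtain ⟨M, hM⟩ := π.mesh_to_zero ε hε
  refine ⟨M, fun N hN => ?_⟩
  have := hM N hN 0 (π.c_pos N)
  rw [zero_add, π.first, sub_zero] at this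
  rwa [Real.dist_eq, sub_zero, abs_of_nonneg (π.t_nonneg (π.c_pos N))]

variable {X}

theorem tendsto_quadSum_zero (hX : ContinuousOn X (Set.Icc 0 T)) :
    Tendsto (fun N => π.quadSum X N 0) atTop (𝓝 0) := by
  have hT : 0 ≤ T := (π.t_nonneg le_rfl).trans_eq (π.last 0)
  have h1 : Tendsto (fun N => π.t N 1) atTop (𝓝[Set.Icc 0 T] 0) :=
    tendsto_nhdsWithin_iff.2 ⟨π.tendsto_t_one, .of_forall fun N =>
      ⟨π.t_nonneg (π.c_pos N), by
        rcases (show 1 ≤ π.c N from π.c_pos N).lt_or_eq with h | h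
        · exact (π.t_lt_last h).le
        · rw [h, π.last]⟩⟩
  have h2 := (((hX 0 ⟨le_rfl, hT⟩).tendsto.comp h1).sub_const (X 0)).pow 2
  simpa [quadSum_zero, Function.comp_def] using h2

/-- Convergence of the partial sums on `[0, T]` extends to the whole line, with limit the constant
extension of the limit on `[0, T]`. -/
theorem tendsto_quadSum_projIcc (hT : 0 ≤ T) (hX : ContinuousOn X (Set.Icc 0 T)) {QV : ℝ → ℝ}
    (h : ∀ s ∈ Set.Icc 0 T, Tendsto (fun N => π.quadSum X N s) atTop (𝓝 (QV s))) (s : ℝ) :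
    Tendsto (fun N => π.quadSum X N s) atTop (𝓝 (QV (Set.projIcc 0 T hT s))) := by
  rcases lt_or_ge s 0 with hs | hs
  · rw [Set.projIcc_of_le_left hT hs.le,
      tendsto_nhds_unique (h 0 ⟨le_rfl, hT⟩) (π.tendsto_quadSum_zero hX)]
    simp [π.quadSum_of_neg X _ hs]
  rcases le_or_gt s T with hsT | hsT
  · rw [Set.projIcc_of_mem hT ⟨hs, hsT⟩]
    exact h s ⟨hs, hsT⟩
  · rw [Set.projIcc_of_right_le hT hsT.le]
    simpa [π.quadSum_of_le X _ hsT.le, π.quadSum_of_le X _ le_rfl] using h T ⟨hT, le_rfl⟩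

end PartitionSeq

section quadMeasure

variable {T : ℝ} (π : PartitionSeq T) (X : ℝ → ℝ)

theorem quadMeasure_Iic (N : ℕ) (s : ℝ) :
    quadMeasure π X N (Set.Iic s) = ENNReal.ofReal (π.quadSum X N s) := by
  rw [PartitionSeq.quadSum, ENNReal.ofReal_sum_of_nonneg fun _ _ => sq_nonneg _, Finset.sum_filter]
  simp [quadMeasure, Set.indicator_apply]

theorem quadMeasure_univ (N : ℕ) :
    quadMeasure π X N Set.univ = ENNReal.ofReal (π.quadSum X N T) := by
  rw [π.quadSum_of_le X N le_rfl, ENNReal.ofReal_sum_of_nonneg fun _ _ => sq_nonneg _]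
  simp [quadMeasure]

instance (N : ℕ) : IsFiniteMeasure (quadMeasure π X N) :=
  ⟨by simp [quadMeasure_univ]⟩

theorem quadMeasure_Iio_zero (N : ℕ) : quadMeasure π X N (Set.Iio 0) = 0 := by
  simp only [quadMeasure, Measure.coe_finsetSum, Finset.sum_apply, Finset.sum_eq_zero_iff,
    Finset.mem_range]
  intro i hi
  simp [π.t_nonneg hi.le]

/-- The measure `quadMeasure π X N` as a finite measure. -/
noncomputable def quadFiniteMeasure (N : ℕ) : FiniteMeasure ℝ := ⟨quadMeasure π X N, inferInstance⟩

theorem coe_quadFiniteMeasure_Iic (N : ℕ) (s : ℝ) :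
    (quadFiniteMeasure π X N (Set.Iic s) : ℝ) = π.quadSum X N s := by
  change (quadMeasure π X N (Set.Iic s)).toReal = _
  rw [quadMeasure_Iic, ENNReal.toReal_ofReal (π.quadSum_nonneg X N s)]

theorem coe_quadFiniteMeasure_mass (N : ℕ) :
    ((quadFiniteMeasure π X N).mass : ℝ) = π.quadSum X N T := by
  change (quadMeasure π X N Set.univ).toReal = _
  rw [quadMeasure_univ, ENNReal.toReal_ofReal (π.quadSum_nonneg X N T)]

variable {π X} {μ : FiniteMeasure ℝ}

theorem tendsto_quadSum_of_tendsto (hμ : ∀ x, (μ : Measure ℝ) {x} = 0)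
    (h : Tendsto (quadFiniteMeasure π X) atTop (𝓝 μ)) (s : ℝ) :
    Tendsto (fun N => π.quadSum X N s) atTop (𝓝 ((μ : Measure ℝ).real (Set.Iic s))) := by
  have := FiniteMeasure.tendsto_measure_of_null_frontier_of_tendsto_nhds h (E := Set.Iic s)
    (by rw [frontier_Iic, FiniteMeasure.null_iff_toMeasure_null, hμ])
  simp only [← coe_quadFiniteMeasure_Iic]
  exact NNReal.tendsto_coe.2 this

theorem measure_Iio_zero_of_tendsto (hμ : ∀ x, (μ : Measure ℝ) {x} = 0)
    (h : Tendsto (quadFiniteMeasure π X) atTop (𝓝 μ)) : (μ : Measure ℝ) (Set.Iio 0) = 0 := by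
  have := FiniteMeasure.tendsto_measure_of_null_frontier_of_tendsto_nhds h (E := Set.Iio 0)
    (by rw [frontier_Iio, FiniteMeasure.null_iff_toMeasure_null, hμ])
  have hzero : ∀ N, quadFiniteMeasure π X N (Set.Iio 0) = 0 := fun N =>
    (FiniteMeasure.null_iff_toMeasure_null _ _).2 (quadMeasure_Iio_zero π X N)
  simp only [hzero] at this
  exact (FiniteMeasure.null_iff_toMeasure_null _ _).1 (tendsto_nhds_unique this tendsto_const_nhds)

end quadMeasure

theorem MeasureTheory.continuous_measureReal_Iic (μ : Measure ℝ) [IsFiniteMeasure μ] [NullSingletonClass μ] :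
    Continuous fun x => μ.real (Set.Iic x) := by
  have h := intervalIntegral.continuous_primitive (μ := μ) (f := fun _ => (1 : ℝ))
    (fun a b => intervalIntegrable_const) 0
  refine (h.add_const (μ.real (Set.Iic 0))).congr fun x => ?_
  have := intervalIntegral.integral_Iic_sub_Iic (μ := μ) (f := fun _ => (1 : ℝ)) (a := 0) (b := x)
    (integrable_const _).integrableOn (integrable_const _).integrableOn
  simp only [setIntegral_const, smul_eq_mul, mul_one] at this
  linarith

/-- Characterisation of finite quadratic variation along a partition sequence:
weak convergence of the discrete measures `μ_N` to an atomless finite measure is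
equivalent to pointwise convergence of the partial sums of squared increments to a
continuous function `[X]`; moreover the limits agree via `μ([0,t]) = [X]_t`. -/
theorem quadratic_variation_characterisation
    (T : ℝ) (hT : 0 < T) (π : PartitionSeq T)
    (X : ℝ → ℝ) (hXc : ContinuousOn X (Set.Icc 0 T)) :
    ((∃ μ : Measure ℝ, IsFiniteMeasure μ ∧ (∀ x : ℝ, μ {x} = 0) ∧
        ∀ f : BoundedContinuousFunction ℝ ℝ,
          Tendsto (fun N => ∫ x, f x ∂(quadMeasure π X N)) atTop (nhds (∫ x, f x ∂μ))) ↔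
      (∃ QV : ℝ → ℝ, ContinuousOn QV (Set.Icc 0 T) ∧
        ∀ t ∈ Set.Icc (0 : ℝ) T,
          Tendsto (fun N => ∑ i ∈ (Finset.range (π.c N)).filter (fun i => π.t N i ≤ t),
              (X (π.t N (i + 1)) - X (π.t N i)) ^ 2)
            atTop (nhds (QV t)))) ∧
    (∀ (μ : Measure ℝ) (QV : ℝ → ℝ),
      (IsFiniteMeasure μ ∧ (∀ x : ℝ, μ {x} = 0) ∧
        ∀ f : BoundedContinuousFunction ℝ ℝ,
          Tendsto (fun N => ∫ x, f x ∂(quadMeasure π X N)) atTop (nhds (∫ x, f x ∂μ))) →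
      (ContinuousOn QV (Set.Icc 0 T) ∧
        ∀ t ∈ Set.Icc (0 : ℝ) T,
          Tendsto (fun N => ∑ i ∈ (Finset.range (π.c N)).filter (fun i => π.t N i ≤ t),
              (X (π.t N (i + 1)) - X (π.t N i)) ^ 2)
            atTop (nhds (QV t))) →
      ∀ t ∈ Set.Icc (0 : ℝ) T, μ (Set.Icc 0 t) = ENNReal.ofReal (QV t)) := by
  have hweak : ∀ (μ : Measure ℝ) (hμ : IsFiniteMeasure μ),
      (∀ f : BoundedContinuousFunction ℝ ℝ,
        Tendsto (fun N => ∫ x, f x ∂(quadMeasure π X N)) atTop (nhds (∫ x, f x ∂μ))) ↔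
      Tendsto (quadFiniteMeasure π X) atTop (𝓝 (⟨μ, hμ⟩ : FiniteMeasure ℝ)) := fun μ hμ =>
    (FiniteMeasure.tendsto_iff_forall_integral_tendsto (μs := quadFiniteMeasure π X)
      (μ := ⟨μ, hμ⟩)).symm
  refine ⟨⟨?_, ?_⟩, ?_⟩
  · rintro ⟨μ, hfin, hatom, hlim⟩
    have : NullSingletonClass μ := ⟨hatom⟩
    exact ⟨fun s => μ.real (Set.Iic s), (continuous_measureReal_Iic μ).continuousOn, fun s _ =>
      tendsto_quadSum_of_tendsto (μ := ⟨μ, hfin⟩) hatom ((hweak μ hfin).1 hlim) s⟩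
  · rintro ⟨QV, hcont, hlim⟩
    have hF := π.tendsto_quadSum_projIcc hT.le hXc hlim
    have hFc : Continuous fun s => QV (Set.projIcc 0 T hT.le s) :=
      hcont.comp_continuous (continuous_subtype_val.comp continuous_projIcc) fun s =>
        (Set.projIcc 0 T hT.le s).2
    let F : StieltjesFunction ℝ :=
      { toFun := fun s => QV (Set.projIcc 0 T hT.le s)
        mono' := fun a b hab => le_of_tendsto_of_tendsto' (hF a) (hF b) fun N =>
          π.quadSum_mono X N hab
        right_continuous' := fun s => hFc.continuousWithinAt }
    have hbot : Tendsto F atBot (𝓝 0) := by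
      refine tendsto_const_nhds.congr' ?_
      filter_upwards [eventually_lt_atBot 0] with s hs
      refine tendsto_nhds_unique ?_ (hF s)
      simp [π.quadSum_of_neg X _ hs]
    have htop : Tendsto F atTop (𝓝 (QV T)) := by
      refine tendsto_const_nhds.congr' ?_
      filter_upwards [eventually_ge_atTop T] with s hs
      change QV T = QV _
      rw [Set.projIcc_of_right_le hT.le hs]
    have hnonneg : ∀ s, 0 ≤ F s := fun s => ge_of_tendsto' (hF s) fun N => π.quadSum_nonneg X N s
    have hQV : 0 ≤ QV T := ge_of_tendsto' htop hnonneg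
    have hfin : IsFiniteMeasure F.measure := F.isFiniteMeasure hbot htop
    refine ⟨F.measure, hfin, fun x => ?_, (hweak _ hfin).2 ?_⟩
    · have hleft : Function.leftLim F x = F x := hFc.continuousAt.continuousWithinAt.leftLim_eq
      rw [F.measure_singleton, hleft, sub_self, ENNReal.ofReal_zero]
    · refine FiniteMeasure.tendsto_of_tendsto_measure_Iic ?_ fun s => ?_
      · rw [← NNReal.tendsto_coe]
        simp only [coe_quadFiniteMeasure_mass]
        have huniv : (F.measure Set.univ).toReal = QV T := by
          rw [F.measure_univ hbot htop, sub_zero, ENNReal.toReal_ofReal hQV]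
        exact (hlim T ⟨hT.le, le_rfl⟩).trans_eq (congrArg 𝓝 huniv.symm)
      · rw [← NNReal.tendsto_coe]
        simp only [coe_quadFiniteMeasure_Iic]
        have hIic : (F.measure (Set.Iic s)).toReal = QV (Set.projIcc 0 T hT.le s) := by
          rw [F.measure_Iic hbot, sub_zero, ENNReal.toReal_ofReal (hnonneg s)]
        exact (hF s).trans_eq (congrArg 𝓝 hIic.symm)
  · rintro μ QV ⟨hfin, hatom, hlim⟩ ⟨-, hQV⟩ s hs
    have hμ := (hweak μ hfin).1 hlim
    have hIio : μ (Set.Iio 0) = 0 := measure_Iio_zero_of_tendsto (μ := ⟨μ, hfin⟩) hatom hμ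
    have hIic : μ.real (Set.Iic s) = QV s :=
      tendsto_nhds_unique (tendsto_quadSum_of_tendsto (μ := ⟨μ, hfin⟩) hatom hμ s) (hQV s hs)
    rw [← hIic, ofReal_measureReal, ← Set.Iio_union_Icc_eq_Iic hs.1]
    exact (measure_congr (union_ae_eq_right_of_ae_eq_empty (ae_eq_empty.2 hIio))).symm
end
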